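/- Gradient descent on a smooth convex function converges at rate O(1/k): let f : E → ℝ be convex and differentiable with L-Lipschitz gradient (L > 0), let x* be a global minimizer of f, and define the iterates x_{k+1} = x_k − (1/L) · ∇f(x_k) starting from any x_0. Then for every k ≥ 1, f(x_k) − f(x*) ≤ L · ‖x_0 − x*‖² / (2k). -/

import Mathlib

open InnerProductSpace

section GradientInequalities

variable {E : Type*} [NormedAddCommGroup E] [InnerProductSpace ℝ E] [CompleteSpace E]

theorem HasGradientAt.hasDerivAt_add_smul {f : E → ℝ} {g x v : E} {t : ℝ}
    (h : HasGradientAt f g (x + t • v)) :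
    HasDerivAt (fun s : ℝ => f (x + s • v)) ⟪g, v⟫_ℝ t := by
  have hline : HasDerivAt (fun s : ℝ => x + s • v) v t := by
    simpa using ((hasDerivAt_id t).smul_const v).const_add x
  simpa [Function.comp_def] using h.hasFDerivAt.comp_hasDerivAt t hline

/-- First-order characterization of convexity: the graph lies above its tangent planes. -/
theorem ConvexOn.add_inner_gradient_le {f : E → ℝ} {g x : E} (hf : ConvexOn ℝ Set.univ f)
    (h : HasGradientAt f g x) (y : E) : f x + ⟪g, y - x⟫_ℝ ≤ f y := by
  have hd : HasDerivAt (fun s : ℝ => f (x + s • (y - x))) ⟪g, y - x⟫_ℝ 0 :=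
    HasGradientAt.hasDerivAt_add_smul (by simpa using h)
  have hc : ConvexOn ℝ Set.univ (fun s : ℝ => f (x + s • (y - x))) := by
    simpa [Function.comp_def, AffineMap.lineMap_apply, add_comm] using
      hf.comp_affineMap (AffineMap.lineMap x y : ℝ →ᵃ[ℝ] E)
  have := hc.le_slope_of_hasDerivAt (Set.mem_univ 0) (Set.mem_univ 1) one_pos hd
  simp [slope_def_field] at this
  linarith

/-- The descent lemma: a function with `L`-Lipschitz gradient has a quadratic upper bound. -/
theorem le_add_inner_gradient_add_sq {f : E → ℝ} {f' : E → E} {L : ℝ}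
    (hgrad : ∀ x, HasGradientAt f (f' x) x) (hlip : ∀ x y, ‖f' x - f' y‖ ≤ L * ‖x - y‖)
    (x v : E) : f (x + v) ≤ f x + ⟪f' x, v⟫_ℝ + L / 2 * ‖v‖ ^ 2 := by
  have hd (t : ℝ) : HasDerivAt
      (fun s : ℝ => f (x + s • v) - s * ⟪f' x, v⟫_ℝ - s ^ 2 * (L / 2 * ‖v‖ ^ 2))
      (⟪f' (x + t • v), v⟫_ℝ - ⟪f' x, v⟫_ℝ - 2 * t * (L / 2 * ‖v‖ ^ 2)) t := by
    have h₁ : HasDerivAt (fun s : ℝ => s * ⟪f' x, v⟫_ℝ) ⟪f' x, v⟫_ℝ t := by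
      simpa using (hasDerivAt_id t).mul_const ⟪f' x, v⟫_ℝ
    have h₂ : HasDerivAt (fun s : ℝ => s ^ 2 * (L / 2 * ‖v‖ ^ 2))
        (2 * t * (L / 2 * ‖v‖ ^ 2)) t := by
      simpa using (hasDerivAt_pow 2 t).mul_const (L / 2 * ‖v‖ ^ 2)
    exact ((hgrad (x + t • v)).hasDerivAt_add_smul.sub h₁).sub h₂
  have hanti := antitoneOn_of_deriv_nonpos (convex_Icc (0 : ℝ) 1)
    (fun t _ => (hd t).continuousAt.continuousWithinAt)
    (fun t _ => (hd t).differentiableAt.differentiableWithinAt) (fun t ht => by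
      rw [interior_Icc] at ht
      rw [(hd t).deriv, ← inner_sub_left]
      have hnorm : ‖f' (x + t • v) - f' x‖ ≤ L * (t * ‖v‖) := by
        simpa [norm_smul, abs_of_pos ht.1] using hlip (x + t • v) x
      have := real_inner_le_norm (f' (x + t • v) - f' x) v
      nlinarith [mul_le_mul_of_nonneg_right hnorm (norm_nonneg v)])
  have := hanti (Set.left_mem_Icc.2 zero_le_one) (Set.right_mem_Icc.2 zero_le_one) zero_le_one
  simp at this
  linarith

/-- A gradient step of length `1 / L` decreases the objective by at least `‖∇f‖² / (2 L)`. -/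
theorem gradient_step_le {f : E → ℝ} {f' : E → E} {L : ℝ} (hL : 0 < L)
    (hgrad : ∀ x, HasGradientAt f (f' x) x) (hlip : ∀ x y, ‖f' x - f' y‖ ≤ L * ‖x - y‖)
    (x : E) : f (x - (1 / L) • f' x) ≤ f x - ‖f' x‖ ^ 2 / (2 * L) := by
  have h := le_add_inner_gradient_add_sq hgrad hlip x (-((1 / L) • f' x))
  rw [← sub_eq_add_neg, inner_neg_right, real_inner_smul_right, real_inner_self_eq_norm_sq,
    norm_neg, norm_smul, Real.norm_of_nonneg (by positivity)] at h
  convert h using 1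
  field_simp
  ring

/-- The gap to the value at `z` after a gradient step is controlled by the decrease of the squared
distance to `z`. -/
theorem ConvexOn.gradient_step_sub_le {f : E → ℝ} {f' : E → E} {L : ℝ} (hL : 0 < L)
    (hf : ConvexOn ℝ Set.univ f)
    (hgrad : ∀ x, HasGradientAt f (f' x) x) (hlip : ∀ x y, ‖f' x - f' y‖ ≤ L * ‖x - y‖)
    (x z : E) : f (x - (1 / L) • f' x) - f z ≤
      L / 2 * (‖x - z‖ ^ 2 - ‖x - (1 / L) • f' x - z‖ ^ 2) := by
  have hstep := gradient_step_le hL hgrad hlip x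
  have hconv := hf.add_inner_gradient_le (hgrad x) z
  rw [← neg_sub x z, inner_neg_right, real_inner_comm] at hconv
  have hdist : L / 2 * (‖x - z‖ ^ 2 - ‖x - (1 / L) • f' x - z‖ ^ 2) =
      ⟪x - z, f' x⟫_ℝ - ‖f' x‖ ^ 2 / (2 * L) := by
    rw [sub_right_comm, norm_sub_sq_real (x - z), real_inner_smul_right, norm_smul,
      Real.norm_of_nonneg (by positivity)]
    field_simp
    ring
  linarith

end GradientInequalities

/-- Gradient descent on a smooth convex function converges at rate `O(1/k)`:
if `f` is convex with `L`-Lipschitz gradient `f'` (`L > 0`), `xstar` is a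
global minimizer of `f`, and `x (k+1) = x k − (1/L) • f' (x k)`, then for every
`k ≥ 1`, `f (x k) − f xstar ≤ L · ‖x 0 − xstar‖² / (2 k)`. -/
theorem gradient_descent_convergence {E : Type*} [NormedAddCommGroup E]
    [InnerProductSpace ℝ E] [FiniteDimensional ℝ E]
    (f : E → ℝ) (f' : E → E) (L : ℝ) (hL : 0 < L)
    (hconv : ConvexOn ℝ Set.univ f)
    (hgrad : ∀ x, HasGradientAt f (f' x) x)
    (hlip : ∀ x y, ‖f' x - f' y‖ ≤ L * ‖x - y‖)
    (xstar : E) (hmin : ∀ x, f xstar ≤ f x)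
    (x : ℕ → E) (hiter : ∀ k, x (k + 1) = x k - (1 / L) • f' (x k)) :
    ∀ k : ℕ, 1 ≤ k → f (x k) - f xstar ≤ L * ‖x 0 - xstar‖ ^ 2 / (2 * k) := by
  have hbound (k : ℕ) :
      k * (f (x k) - f xstar) ≤ L / 2 * (‖x 0 - xstar‖ ^ 2 - ‖x k - xstar‖ ^ 2) := by
    induction k with
    | zero => simp
    | succ k ih =>
      have hgap := hconv.gradient_step_sub_le hL hgrad hlip (x k) xstar
      have hstep := gradient_step_le hL hgrad hlip (x k)
      rw [← hiter] at hgap hstep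
      have hdecr : f (x (k + 1)) ≤ f (x k) := hstep.trans (sub_le_self _ (by positivity))
      have := mul_le_mul_of_nonneg_left hdecr (Nat.cast_nonneg (α := ℝ) k)
      push_cast
      linarith
  intro k hk
  have hk' : (0 : ℝ) < k := by exact_mod_cast hk
  rw [le_div_iff₀ (by positivity)]
  nlinarith [hbound k, mul_nonneg hL.le (sq_nonneg ‖x k - xstar‖)]
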